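/- arXiv:2201.05879 — 4 statements merged into one kernel-verified Lean document; each statement's English description precedes it below -/
import Mathlib

section
/- For n ≥ 1, OR_n · OR_n = OP_n: the composite of any two orientation-reversing maps of [n] is orientation-preserving, and conversely every orientation-preserving map of [n] is a composite of two orientation-reversing maps. -/
/-- A finite sequence `a : Fin t → α` is *cyclic* if there is at most one index `i`
(indices modulo `t`) with `a i > a (i+1)`. -/
def IsCyclicSeq {t : ℕ} {α : Type*} [LinearOrder α] (a : Fin t → α) : Prop :=
  (Finset.univ.filter fun i : Fin t => a (finRotate t i) < a i).card ≤ 1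

/-- A finite sequence `a : Fin t → α` is *anti-cyclic* if there is at most one index `i`
(indices modulo `t`) with `a i < a (i+1)`. -/
def IsAntiCyclicSeq {t : ℕ} {α : Type*} [LinearOrder α] (a : Fin t → α) : Prop :=
  (Finset.univ.filter fun i : Fin t => a i < a (finRotate t i)).card ≤ 1

/-- A sequence is *oriented* if it is cyclic or anti-cyclic. -/
def IsOrientedSeq {t : ℕ} {α : Type*} [LinearOrder α] (a : Fin t → α) : Prop :=
  IsCyclicSeq a ∨ IsAntiCyclicSeq a

/-- `HasCut a c` says that the sequence `a` read cyclically from position `c` is monotone. -/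
def HasCut {t : ℕ} {α : Type*} [LinearOrder α] (a : Fin t → α) (c : ℕ) : Prop :=
  ∀ i j : Fin t, i ≤ j →
    ((j.val < c ∨ c ≤ i.val) → a i ≤ a j) ∧ (i.val < c → c ≤ j.val → a j ≤ a i)

lemma le_of_forall_succ_le {t : ℕ} {α : Type*} [LinearOrder α] (a : Fin t → α) (i j : Fin t)
    (hij : i ≤ j)
    (h : ∀ k (hk : k + 1 < t), i.val ≤ k → k < j.val → a ⟨k, by omega⟩ ≤ a ⟨k + 1, hk⟩) :
    a i ≤ a j := by
  obtain ⟨i, hi⟩ := i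
  obtain ⟨j, hj⟩ := j
  have hij' : i ≤ j := hij
  clear hij
  induction j, hij' using Nat.le_induction with
  | base => exact le_rfl
  | succ k hk ih =>
    exact (ih (by omega) fun l hl h₁ h₂ => h l hl h₁ (Nat.lt_succ_of_lt h₂)).trans
      (h k hj hk (Nat.lt_succ_self k))

lemma isCyclicSeq_iff_exists_hasCut {t : ℕ} {α : Type*} [LinearOrder α] (a : Fin t → α) :
    IsCyclicSeq a ↔ ∃ c, HasCut a c := by
  obtain _ | m := t
  · exact ⟨fun _ => ⟨0, fun i => i.elim0⟩, fun _ => by simp [IsCyclicSeq]⟩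
  have hrot (k : ℕ) (hk : k + 1 < m + 1) :
      finRotate (m + 1) ⟨k, by omega⟩ = ⟨k + 1, hk⟩ := finRotate_of_lt (by omega)
  have hlast : finRotate (m + 1) ⟨m, by omega⟩ = ⟨0, by omega⟩ := finRotate_last'
  simp only [IsCyclicSeq, Finset.card_le_one, Finset.mem_filter, Finset.mem_univ, true_and]
  constructor
  · intro h
    by_cases hd : ∃ k, ∃ hk : k + 1 < m + 1, a ⟨k + 1, hk⟩ < a ⟨k, by omega⟩
    · obtain ⟨k, hk, hlt⟩ := hd
      have huniq (l : ℕ) (hl : l + 1 < m + 1) (hne : l ≠ k) :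
          a ⟨l, by omega⟩ ≤ a ⟨l + 1, hl⟩ := by
        by_contra! hc
        have := h ⟨l, by omega⟩ (by rwa [hrot l hl]) ⟨k, by omega⟩ (by rwa [hrot k hk])
        exact hne (Fin.mk.inj this)
      have hends : a ⟨m, by omega⟩ ≤ a ⟨0, by omega⟩ := by
        by_contra! hc
        have := Fin.mk.inj <|
          h ⟨m, by omega⟩ (by rwa [hlast]) ⟨k, by omega⟩ (by rwa [hrot k hk])
        omega
      refine ⟨k + 1, fun i j hij => ⟨fun hc => ?_, fun hi hj => ?_⟩⟩
      · exact le_of_forall_succ_le a i j hij fun l hl h₁ h₂ => huniq l hl (by omega)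
      · refine (le_of_forall_succ_le a j ⟨m, by omega⟩ (Fin.le_last j) fun l hl h₁ _ =>
          huniq l hl (by omega)).trans (hends.trans ?_)
        exact le_of_forall_succ_le a ⟨0, by omega⟩ i (Fin.zero_le i) fun l hl _ h₂ =>
          huniq l hl (by omega)
    · push Not at hd
      refine ⟨0, fun i j hij => ⟨fun _ => ?_, fun hi => absurd hi (Nat.not_lt_zero _)⟩⟩
      exact le_of_forall_succ_le a i j hij fun l hl _ _ => hd l hl
  · rintro ⟨c, hc⟩
    have hdesc (i : Fin (m + 1)) (hi : a (finRotate (m + 1) i) < a i) :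
        (i.val + 1 = c ∧ c ≤ m) ∨ (i.val = m ∧ (c = 0 ∨ m < c)) := by
      obtain ⟨i, hi'⟩ := i
      by_cases him : i = m
      · subst him
        rw [hlast] at hi
        have := (hc ⟨0, by omega⟩ ⟨i, by omega⟩ (Fin.zero_le _)).2
        refine Or.inr ⟨rfl, ?_⟩
        by_contra! hcon
        exact absurd (this (by simp only; omega) (by simp only; omega)) (not_le.2 hi)
      · rw [hrot i (by omega)] at hi
        have := (hc ⟨i, by omega⟩ ⟨i + 1, by omega⟩ (Fin.mk_le_mk.2 (Nat.le_succ i))).1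
        refine Or.inl (show i + 1 = c ∧ c ≤ m from ?_)
        by_contra hcon
        exact absurd (this (by simp only; omega)) (not_le.2 hi)
    intro i hi j hj
    have := hdesc i hi
    have := hdesc j hj
    omega

lemma isAntiCyclicSeq_iff_exists_hasCut {t : ℕ} {α : Type*} [LinearOrder α] (a : Fin t → α) :
    IsAntiCyclicSeq a ↔ ∃ c, HasCut (fun i => OrderDual.toDual (a i)) c :=
  isCyclicSeq_iff_exists_hasCut fun i => OrderDual.toDual (a i)

lemma exists_first_index {t : ℕ} (P : Fin t → Prop) (hP : ∃ i, P i) :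
    ∃ i, P i ∧ ∀ j < i, ¬ P j := by
  obtain ⟨i, hi, hmin⟩ := WellFounded.has_min (wellFounded_lt (α := Fin t)) {i | P i} hP
  exact ⟨i, hi, fun j hj hPj => hmin j hPj hj⟩

lemma IsAntiCyclicSeq.comp {s t : ℕ} {γ : Type*} [LinearOrder γ] {α : Fin s → Fin t}
    {β : Fin t → γ} (hα : IsAntiCyclicSeq α) (hβ : IsAntiCyclicSeq β) :
    IsCyclicSeq fun x => β (α x) := by
  obtain ⟨k, hk⟩ := (isAntiCyclicSeq_iff_exists_hasCut α).1 hα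
  obtain ⟨m, hm⟩ := (isAntiCyclicSeq_iff_exists_hasCut β).1 hβ
  rw [isCyclicSeq_iff_exists_hasCut]
  simp only [HasCut, OrderDual.toDual_le_toDual, Fin.le_def] at hk hm ⊢
  by_cases h₁ : ∃ i : Fin s, k ≤ i.val ∧ (α i).val < m
  · obtain ⟨c, ⟨hck, hcm⟩, hmin⟩ := exists_first_index _ h₁
    refine ⟨c, fun i j hij => ?_⟩
    have := hk i j hij
    have := hm (α i) (α j)
    have := hm (α j) (α i)
    grind
  · by_cases h₂ : ∃ i : Fin s, i.val < k ∧ (α i).val < m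
    · obtain ⟨c, ⟨hck, hcm⟩, hmin⟩ := exists_first_index _ h₂
      refine ⟨c, fun i j hij => ?_⟩
      have := hk i j hij
      have := hm (α i) (α j)
      have := hm (α j) (α i)
      grind
    · refine ⟨k, fun i j hij => ?_⟩
      have := hk i j hij
      have := hm (α i) (α j)
      have := hm (α j) (α i)
      grind

lemma isAntiCyclicSeq_rev (n : ℕ) : IsAntiCyclicSeq (Fin.rev : Fin n → Fin n) :=
  (isAntiCyclicSeq_iff_exists_hasCut _).2
    ⟨0, fun _ _ hij => ⟨fun _ => Fin.rev_le_rev.2 hij, fun h => absurd h (Nat.not_lt_zero _)⟩⟩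

lemma IsCyclicSeq.comp_rev {t : ℕ} {α : Type*} [LinearOrder α] {a : Fin t → α}
    (h : IsCyclicSeq a) : IsAntiCyclicSeq fun i => a i.rev := by
  obtain ⟨c, hc⟩ := (isCyclicSeq_iff_exists_hasCut a).1 h
  refine (isAntiCyclicSeq_iff_exists_hasCut _).2 ⟨t - c, fun i j hij => ?_⟩
  have := hc j.rev i.rev (Fin.rev_le_rev.2 hij)
  simp only [Fin.val_rev, OrderDual.toDual_le_toDual] at this ⊢
  exact ⟨fun h => this.1 (by omega), fun hi hj => this.2 (by omega) (by omega)⟩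

/-- `OR_n · OR_n = OP_n`: a map is a composite (first `α`, then `β`) of two
orientation-reversing maps iff it is orientation-preserving. -/
theorem or_mul_or_eq_op (n : ℕ) (hn : 1 ≤ n) (f : Fin n → Fin n) :
    (∃ α β : Fin n → Fin n, IsAntiCyclicSeq α ∧ IsAntiCyclicSeq β ∧
        f = fun x => β (α x)) ↔ IsCyclicSeq f := by
  constructor
  · rintro ⟨α, β, hα, hβ, rfl⟩
    exact hα.comp hβ
  · intro hf
    exact ⟨Fin.rev, fun i => f i.rev, isAntiCyclicSeq_rev n, hf.comp_rev, by simp⟩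
end

section
/- A map α : [n] → [n] belongs to P_n = OP_n ∪ OR_n if and only if for every oriented quadruple S = (a, b, c, d) of elements of [n], the image sequence Sα = (aα, bα, cα, dα) is also oriented. -/
/-- `x ≤ y ≤ z ≤ w` holds for some rotation of the quadruple. -/
def CyclicQuad {β : Type*} [LinearOrder β] (x y z w : β) : Prop :=
  (x ≤ y ∧ y ≤ z ∧ z ≤ w) ∨ (y ≤ z ∧ z ≤ w ∧ w ≤ x) ∨
    (z ≤ w ∧ w ≤ x ∧ x ≤ y) ∨ (w ≤ x ∧ x ≤ y ∧ y ≤ z)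

/-- `x < y < z` holds for some rotation of the triple. -/
def StrictCyclic {β : Type*} [LinearOrder β] (x y z : β) : Prop :=
  (x < y ∧ y < z) ∨ (y < z ∧ z < x) ∨ (z < x ∧ x < y)

/-- `f` is injective on `{i, j, k}` and keeps the cyclic orientation of the triple. -/
def KeepsTriple {ι β : Type*} [LinearOrder ι] [LinearOrder β] (f : ι → β) (i j k : ι) : Prop :=
  (StrictCyclic i j k ∧ StrictCyclic (f i) (f j) (f k)) ∨
    (StrictCyclic k j i ∧ StrictCyclic (f k) (f j) (f i))

/-- `f` is injective on `{i, j, k}` and flips the cyclic orientation of the triple. -/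
def FlipsTriple {ι β : Type*} [LinearOrder ι] [LinearOrder β] (f : ι → β) (i j k : ι) : Prop :=
  (StrictCyclic i j k ∧ StrictCyclic (f k) (f j) (f i)) ∨
    (StrictCyclic k j i ∧ StrictCyclic (f i) (f j) (f k))

/-- The image of every cyclic quadruple is cyclic or anti-cyclic. -/
def OrientsQuads {ι β : Type*} [LinearOrder ι] [LinearOrder β] (f : ι → β) : Prop :=
  ∀ a b c d, CyclicQuad a b c d →
    CyclicQuad (f a) (f b) (f c) (f d) ∨ CyclicQuad (f d) (f c) (f b) (f a)

section Triples

variable {ι β : Type*} [LinearOrder ι] [LinearOrder β]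

lemma StrictCyclic.rotate {x y z : β} (h : StrictCyclic x y z) : StrictCyclic y z x := by
  unfold StrictCyclic at *; tauto

lemma StrictCyclic.ne {x y z : β} (h : StrictCyclic x y z) : x ≠ y ∧ y ≠ z ∧ x ≠ z := by
  unfold StrictCyclic at h; grind

lemma StrictCyclic.asymm {x y z : β} (h : StrictCyclic x y z) : ¬ StrictCyclic z y x := by
  unfold StrictCyclic at *; grind

lemma strictCyclic_or_of_ne {x y z : β} (hxy : x ≠ y) (hyz : y ≠ z) (hxz : x ≠ z) :
    StrictCyclic x y z ∨ StrictCyclic z y x := by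
  unfold StrictCyclic; grind

/-- Deleting the second entry of a quadruple and deleting its first entry give triples that
cannot have opposite strict orientations if the quadruple is oriented. -/
lemma not_oriented_of_opposite {x y z w : β} (h : CyclicQuad x y z w ∨ CyclicQuad w z y x)
    (h₁ : StrictCyclic x z w) (h₂ : StrictCyclic w z y) : False := by
  unfold CyclicQuad at h; unfold StrictCyclic at h₁ h₂; grind

lemma CyclicQuad.rotate {x y z w : β} (h : CyclicQuad x y z w) : CyclicQuad y z w x := by
  unfold CyclicQuad at *; tauto

lemma KeepsTriple.rotate {f : ι → β} {i j k : ι} (h : KeepsTriple f i j k) :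
    KeepsTriple f j k i :=
  h.imp (fun h => ⟨h.1.rotate, h.2.rotate⟩)
    (fun h => ⟨h.1.rotate.rotate, h.2.rotate.rotate⟩)

lemma KeepsTriple.swap {f : ι → β} {i j k : ι} (h : KeepsTriple f i j k) :
    KeepsTriple f i k j :=
  h.symm.imp (fun h => ⟨h.1.rotate.rotate, h.2.rotate.rotate⟩)
    (fun h => ⟨h.1.rotate, h.2.rotate⟩)

lemma KeepsTriple.ne {f : ι → β} {i j k : ι} (h : KeepsTriple f i j k) :
    f i ≠ f j ∧ f j ≠ f k ∧ f i ≠ f k := by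
  rcases h with ⟨-, h⟩ | ⟨-, h⟩
  · exact h.ne
  · exact ⟨h.ne.2.1.symm, h.ne.1.symm, h.ne.2.2.symm⟩

lemma FlipsTriple.swap {f : ι → β} {i j k : ι} (h : FlipsTriple f i j k) :
    FlipsTriple f i k j :=
  h.symm.imp (fun h => ⟨h.1.rotate.rotate, h.2.rotate⟩)
    (fun h => ⟨h.1.rotate, h.2.rotate.rotate⟩)

lemma FlipsTriple.ne {f : ι → β} {i j k : ι} (h : FlipsTriple f i j k) :
    f i ≠ f j ∧ f j ≠ f k ∧ f i ≠ f k := by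
  rcases h with ⟨-, h⟩ | ⟨-, h⟩
  · exact ⟨h.ne.2.1.symm, h.ne.1.symm, h.ne.2.2.symm⟩
  · exact h.ne

lemma KeepsTriple.not_flips {f : ι → β} {i j k : ι} (h : KeepsTriple f i j k) :
    ¬ FlipsTriple f i j k := by
  rintro (⟨h₁, h₂⟩ | ⟨h₁, h₂⟩) <;> rcases h with ⟨h₃, h₄⟩ | ⟨h₃, h₄⟩
  · exact h₄.asymm h₂
  · exact h₁.asymm h₃
  · exact h₁.asymm h₃
  · exact h₄.asymm h₂

lemma keeps_or_flips {f : ι → β} {i j k : ι} (hij : f i ≠ f j) (hjk : f j ≠ f k)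
    (hik : f i ≠ f k) : KeepsTriple f i j k ∨ FlipsTriple f i j k := by
  have h₁ := strictCyclic_or_of_ne hij hjk hik
  have h₂ := strictCyclic_or_of_ne (mt (congrArg f) hij) (mt (congrArg f) hjk)
    (mt (congrArg f) hik)
  unfold KeepsTriple FlipsTriple; tauto

/-- Cut the circle at `j` and `k`: the point `p` lies either on the same arc as `i` or on the
other arc. -/
lemma cyclicQuad_cases {i j k p : ι} (h : StrictCyclic i j k) :
    (StrictCyclic p j k → CyclicQuad i p j k ∨ CyclicQuad p i j k) ∧
      (StrictCyclic k j p → CyclicQuad i j p k) := by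
  unfold StrictCyclic at *
  unfold CyclicQuad
  constructor <;> intro h' <;> rcases h with h | h | h <;> rcases h' with h' | h' | h' <;>
    rcases le_total i p with hip | hip <;> grind (splits := 20)

lemma OrientsQuads.not_flips_of_strictCyclic {f : ι → β} (hf : OrientsQuads f) {i j k p : ι}
    (h : StrictCyclic i j k) (h' : StrictCyclic (f i) (f j) (f k)) : ¬ FlipsTriple f p j k := by
  rintro (⟨h₁, h₂⟩ | ⟨h₁, h₂⟩)
  · rcases (cyclicQuad_cases h).1 h₁ with hq | hq
    · exact not_oriented_of_opposite (hf _ _ _ _ hq) h' h₂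
    · have := hf _ _ _ _ hq
      unfold CyclicQuad at this; unfold StrictCyclic at h' h₂; grind
  · have := hf _ _ _ _ ((cyclicQuad_cases h).2 h₁)
    unfold CyclicQuad at this; unfold StrictCyclic at h' h₂; grind

/-- The exchange property: replacing one point of a kept triple gives a kept triple, as long as
`f` stays injective on it. -/
lemma OrientsQuads.exchange {f : ι → β} (hf : OrientsQuads f) {i j k p : ι}
    (h : KeepsTriple f i j k) (hj : f p ≠ f j) (hk : f p ≠ f k) : KeepsTriple f p j k := by
  refine (keeps_or_flips hj h.ne.2.1 hk).resolve_right fun hn => ?_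
  rcases h with ⟨h₁, h₂⟩ | ⟨h₁, h₂⟩
  · exact hf.not_flips_of_strictCyclic h₁ h₂ hn
  · exact hf.not_flips_of_strictCyclic h₁.rotate.rotate h₂.rotate.rotate hn.swap

lemma OrientsQuads.not_keeps_and_flips {f : ι → β} (hf : OrientsQuads f) {i j k p q r : ι}
    (h : KeepsTriple f i j k) (h' : FlipsTriple f p q r) : False := by
  obtain ⟨hpq, hqr, hpr⟩ := h'.ne
  obtain ⟨s, t, h₁⟩ : ∃ s t, KeepsTriple f p s t := by
    obtain ⟨hij, hjk, hik⟩ := h.ne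
    by_cases hj : f p = f j
    · exact ⟨_, _, hf.exchange h.rotate (hj ▸ hjk) (hj ▸ hij.symm)⟩
    · by_cases hk : f p = f k
      · exact ⟨_, _, hf.exchange h.rotate.rotate (hk ▸ hik.symm) (hk ▸ hjk.symm)⟩
      · exact ⟨_, _, hf.exchange h hj hk⟩
  obtain ⟨t, h₂⟩ : ∃ t, KeepsTriple f q t p := by
    by_cases ht : f q = f t
    · exact ⟨s, (hf.exchange h₁.rotate.rotate hpq.symm (ht ▸ h₁.ne.2.1.symm)).swap⟩
    · exact ⟨t, hf.exchange h₁.rotate ht hpq.symm⟩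
  exact (hf.exchange h₂.rotate hpr.symm hqr.symm).rotate.not_flips h'

lemma CyclicQuad.exists_strictCyclic {x y z w : β} (h : CyclicQuad x y z w)
    (hn : ¬ CyclicQuad w z y x) :
    StrictCyclic x y z ∨ StrictCyclic x y w ∨ StrictCyclic x z w ∨ StrictCyclic y z w := by
  unfold CyclicQuad at *
  unfold StrictCyclic
  rcases h with h | h | h | h <;> grind (splits := 20)

lemma CyclicQuad.strictCyclic {a b c d : ι} (h : CyclicQuad a b c d) (hab : a ≠ b)
    (hbc : b ≠ c) (hac : a ≠ c) : StrictCyclic a b c := by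
  unfold CyclicQuad at h
  unfold StrictCyclic
  rcases h with h | h | h | h <;> grind

lemma CyclicQuad.exists_keeps {f : ι → β} {a b c d : ι} (h : CyclicQuad a b c d)
    (h₁ : CyclicQuad (f a) (f b) (f c) (f d)) (h₂ : ¬ CyclicQuad (f d) (f c) (f b) (f a)) :
    ∃ i j k, KeepsTriple f i j k := by
  have key : ∀ {a b c d : ι}, CyclicQuad a b c d → StrictCyclic (f a) (f b) (f c) →
      ∃ i j k, KeepsTriple f i j k := fun h hs =>
    ⟨_, _, _, .inl ⟨h.strictCyclic (ne_of_apply_ne f hs.ne.1) (ne_of_apply_ne f hs.ne.2.1)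
      (ne_of_apply_ne f hs.ne.2.2), hs⟩⟩
  rcases h₁.exists_strictCyclic h₂ with hs | hs | hs | hs
  · exact key h hs
  · exact key h.rotate.rotate.rotate hs.rotate.rotate
  · exact key h.rotate.rotate hs.rotate
  · exact key h.rotate hs

lemma CyclicQuad.exists_flips {f : ι → β} {a b c d : ι} (h : CyclicQuad a b c d)
    (h₁ : CyclicQuad (f d) (f c) (f b) (f a)) (h₂ : ¬ CyclicQuad (f a) (f b) (f c) (f d)) :
    ∃ i j k, FlipsTriple f i j k := by
  have key : ∀ {a b c d : ι}, CyclicQuad a b c d → StrictCyclic (f c) (f b) (f a) →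
      ∃ i j k, FlipsTriple f i j k := fun h hs =>
    ⟨_, _, _, .inl ⟨h.strictCyclic (ne_of_apply_ne f hs.ne.2.1.symm)
      (ne_of_apply_ne f hs.ne.1.symm) (ne_of_apply_ne f hs.ne.2.2.symm), hs⟩⟩
  rcases h₁.exists_strictCyclic h₂ with hs | hs | hs | hs
  · exact key h.rotate hs
  · exact key h.rotate.rotate hs.rotate.rotate
  · exact key h.rotate.rotate.rotate hs.rotate
  · exact key h hs

/-- A map orienting all cyclic quadruples does so in the same way for all of them. -/
lemma OrientsQuads.uniform {f : ι → β} (hf : OrientsQuads f) :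
    (∀ a b c d, CyclicQuad a b c d → CyclicQuad (f a) (f b) (f c) (f d)) ∨
      (∀ a b c d, CyclicQuad a b c d → CyclicQuad (f d) (f c) (f b) (f a)) := by
  by_contra! h
  obtain ⟨⟨a, b, c, d, h₁, h₂⟩, a', b', c', d', h₃, h₄⟩ := h
  obtain ⟨_, _, _, hk⟩ := h₃.exists_keeps ((hf _ _ _ _ h₃).resolve_right h₄) h₄
  obtain ⟨_, _, _, hl⟩ := h₁.exists_flips ((hf _ _ _ _ h₁).resolve_left h₂) h₂
  exact hf.not_keeps_and_flips hk hl

end Triples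

section Sequences

variable {β : Type*} [LinearOrder β]

lemma isCyclicSeq_iff {t : ℕ} (a : Fin t → β) :
    IsCyclicSeq a ↔ ∀ i j, a (finRotate t i) < a i → a (finRotate t j) < a j → i = j := by
  simp only [IsCyclicSeq, Finset.card_le_one, Finset.mem_filter, Finset.mem_univ, true_and]
  exact ⟨fun h i j hi hj => h i hi j hj, fun h i hi j hj => h i j hi hj⟩

lemma isAntiCyclicSeq_iff_toDual {t : ℕ} (a : Fin t → β) :
    IsAntiCyclicSeq a ↔ IsCyclicSeq (OrderDual.toDual ∘ a) := by
  simp [IsAntiCyclicSeq, IsCyclicSeq]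

lemma cyclicQuad_iff (x y z w : β) : CyclicQuad x y z w ↔
    ¬ ((y < x ∧ z < y) ∨ (y < x ∧ w < z) ∨ (y < x ∧ x < w) ∨
      (z < y ∧ w < z) ∨ (z < y ∧ x < w) ∨ (w < z ∧ x < w)) := by
  simp only [CyclicQuad, not_or, not_and, not_lt]
  constructor
  · rintro (h | h | h | h) <;> grind
  · grind (splits := 20)

lemma isCyclicSeq_quad_iff (x y z w : β) : IsCyclicSeq ![x, y, z, w] ↔ CyclicQuad x y z w := by
  rw [isCyclicSeq_iff, cyclicQuad_iff]
  simp [Fin.forall_fin_succ, finRotate_apply]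
  simp only [← not_lt]
  tauto

lemma cyclicQuad_toDual (x y z w : β) :
    CyclicQuad (OrderDual.toDual x) (OrderDual.toDual y) (OrderDual.toDual z)
      (OrderDual.toDual w) ↔ CyclicQuad w z y x := by
  simp only [CyclicQuad, OrderDual.toDual_le_toDual]
  tauto

lemma isAntiCyclicSeq_quad_iff (x y z w : β) :
    IsAntiCyclicSeq ![x, y, z, w] ↔ CyclicQuad w z y x := by
  rw [isAntiCyclicSeq_iff_toDual, ← cyclicQuad_toDual, ← isCyclicSeq_quad_iff]
  congr! 1

lemma isOrientedSeq_quad_iff (x y z w : β) :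
    IsOrientedSeq ![x, y, z, w] ↔ CyclicQuad x y z w ∨ CyclicQuad w z y x := by
  rw [IsOrientedSeq, isCyclicSeq_quad_iff, isAntiCyclicSeq_quad_iff]

lemma exists_descent_of_lt {m : ℕ} (a : Fin (m + 1) → β) {i j : Fin (m + 1)} (hij : i ≤ j)
    (h : a j < a i) : ∃ d, i ≤ d ∧ d < j ∧ a (finRotate _ d) < a d := by
  by_contra! hn
  have key : ∀ k (hk : k < m + 1), i.1 ≤ k → k ≤ j.1 → a i ≤ a ⟨k, hk⟩ := by
    intro k
    induction k with
    | zero =>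
      intro hk hi _
      exact (congrArg a (Fin.ext (Nat.le_zero.1 hi))).le
    | succ k ih =>
      intro hk hi hj
      rcases hi.eq_or_lt with hi | hi
      · exact (congrArg a (Fin.ext hi)).le
      · have := hn ⟨k, by omega⟩ (Fin.le_def.2 (by simp; omega)) (Fin.lt_def.2 (by simp; omega))
        rw [finRotate_of_lt (by omega)] at this
        exact (ih (by omega) (by omega) (by omega)).trans this
  exact absurd (key j j.2 hij le_rfl) h.not_ge

lemma exists_descent_of_gt {m : ℕ} (a : Fin (m + 1) → β) {i j : Fin (m + 1)}
    (h : a i < a j) : ∃ d, (d < i ∨ j ≤ d) ∧ a (finRotate _ d) < a d := by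
  by_contra! hn
  have h₁ : a j ≤ a (Fin.last m) := by
    by_contra! h'
    obtain ⟨d, hd, -, hd'⟩ := exists_descent_of_lt a (Fin.le_last j) h'
    exact absurd (hn d (.inr hd)) hd'.not_ge
  have h₂ : a 0 ≤ a i := by
    by_contra! h'
    obtain ⟨d, -, hd, hd'⟩ := exists_descent_of_lt a (Fin.zero_le i) h'
    exact absurd (hn d (.inl hd)) hd'.not_ge
  have h₃ := hn (Fin.last m) (.inr (Fin.le_last j))
  rw [finRotate_last] at h₃
  exact absurd ((h₁.trans h₃).trans h₂) h.not_ge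

/-- A sequence is cyclic iff it maps cyclic quadruples of indices to cyclic quadruples. -/
lemma isCyclicSeq_iff_forall_cyclicQuad {m : ℕ} (f : Fin (m + 1) → β) :
    IsCyclicSeq f ↔ ∀ a b c d, CyclicQuad a b c d → CyclicQuad (f a) (f b) (f c) (f d) := by
  rw [isCyclicSeq_iff]
  constructor
  · intro h
    have mono : ∀ a b c d, a ≤ b → b ≤ c → c ≤ d → CyclicQuad (f a) (f b) (f c) (f d) := by
      intro a b c d hab hbc hcd
      have h₁ := fun h => exists_descent_of_lt f hab h
      have h₂ := fun h => exists_descent_of_lt f hbc h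
      have h₃ := fun h => exists_descent_of_lt f hcd h
      have h₄ := fun h : f a < f d => exists_descent_of_gt f h
      rw [cyclicQuad_iff]
      rintro (⟨u, v⟩ | ⟨u, v⟩ | ⟨u, v⟩ | ⟨u, v⟩ | ⟨u, v⟩ | ⟨u, v⟩)
      · obtain ⟨p, hp⟩ := h₁ u
        obtain ⟨q, hq⟩ := h₂ v
        have := h p q hp.2.2 hq.2.2
        omega
      · obtain ⟨p, hp⟩ := h₁ u
        obtain ⟨q, hq⟩ := h₃ v
        have := h p q hp.2.2 hq.2.2
        omega
      · obtain ⟨p, hp⟩ := h₁ u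
        obtain ⟨q, hq⟩ := h₄ v
        have := h p q hp.2.2 hq.2
        omega
      · obtain ⟨p, hp⟩ := h₂ u
        obtain ⟨q, hq⟩ := h₃ v
        have := h p q hp.2.2 hq.2.2
        omega
      · obtain ⟨p, hp⟩ := h₂ u
        obtain ⟨q, hq⟩ := h₄ v
        have := h p q hp.2.2 hq.2
        omega
      · obtain ⟨p, hp⟩ := h₃ u
        obtain ⟨q, hq⟩ := h₄ v
        have := h p q hp.2.2 hq.2
        omega
    rintro a b c d (⟨u, v, w⟩ | ⟨u, v, w⟩ | ⟨u, v, w⟩ | ⟨u, v, w⟩)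
    · exact mono _ _ _ _ u v w
    · exact (mono _ _ _ _ u v w).rotate.rotate.rotate
    · exact (mono _ _ _ _ u v w).rotate.rotate
    · exact (mono _ _ _ _ u v w).rotate
  · intro h
    have key : ∀ i j : Fin (m + 1), i < j → f (finRotate _ i) < f i →
        ¬ f (finRotate _ j) < f j := by
      intro i j hij hi hj
      have hi' : i.1 < m := by omega
      rw [finRotate_of_lt hi'] at hi
      rcases (Fin.le_last j).eq_or_lt with rfl | hj'
      · rw [finRotate_last] at hj
        have := h 0 i ⟨i.1 + 1, by omega⟩ (Fin.last m)
          (.inl ⟨Fin.zero_le _, Fin.le_def.2 (by simp), Fin.le_last _⟩)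
        exact (cyclicQuad_iff _ _ _ _).1 this (by tauto)
      · have hj' : j.1 < m := hj'
        rw [finRotate_of_lt hj'] at hj
        have := h i ⟨i.1 + 1, by omega⟩ j ⟨j.1 + 1, by omega⟩
          (.inl ⟨Fin.le_def.2 (by simp), Fin.le_def.2 hij, Fin.le_def.2 (by simp)⟩)
        exact (cyclicQuad_iff _ _ _ _).1 this (by tauto)
    intro i j hi hj
    rcases lt_trichotomy i j with hij | hij | hij
    · exact absurd hj (key i j hij hi)
    · exact hij
    · exact absurd hi (key j i hij hj)

lemma isAntiCyclicSeq_iff_forall_cyclicQuad {m : ℕ} (f : Fin (m + 1) → β) :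
    IsAntiCyclicSeq f ↔ ∀ a b c d, CyclicQuad a b c d → CyclicQuad (f d) (f c) (f b) (f a) := by
  simp only [isAntiCyclicSeq_iff_toDual, isCyclicSeq_iff_forall_cyclicQuad, Function.comp_apply,
    cyclicQuad_toDual]

end Sequences

/-- `α ∈ P_n` iff the image of every oriented quadruple is oriented. -/
theorem p_iff_oriented_quadruples (n : ℕ) (hn : 1 ≤ n) (α : Fin n → Fin n) :
    (IsCyclicSeq α ∨ IsAntiCyclicSeq α) ↔
      ∀ a b c d : Fin n,
        IsOrientedSeq ![a, b, c, d] → IsOrientedSeq ![α a, α b, α c, α d] := by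
  obtain ⟨m, rfl⟩ := Nat.exists_eq_add_of_le' hn
  simp only [isCyclicSeq_iff_forall_cyclicQuad, isAntiCyclicSeq_iff_forall_cyclicQuad,
    isOrientedSeq_quad_iff]
  refine ⟨?_, fun h => OrientsQuads.uniform fun a b c d hq => h a b c d (.inl hq)⟩
  rintro (h | h) a b c d (hq | hq)
  · exact .inl (h _ _ _ _ hq)
  · exact .inr (h _ _ _ _ hq)
  · exact .inr (h _ _ _ _ hq)
  · exact .inl (h _ _ _ _ hq)
end

section
/- Orientation is inherited by subsequences: if S is a cyclic sequence of natural numbers, then every subsequence of S (entries taken in their order of occurrence in S) is cyclic; likewise, every subsequence of an anti-cyclic sequence is anti-cyclic. In particular, every subsequence of an oriented sequence is oriented. -/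
section Descents

variable {α : Type*} [LinearOrder α] {n m : ℕ}

/-- Between two positions with decreasing values there is a descent. -/
theorem exists_descent_of_lt_s16 (a : Fin (n + 1) → α) {u v : Fin (n + 1)}
    (huv : u ≤ v) (h : a v < a u) :
    ∃ i, u ≤ i ∧ i < v ∧ a (finRotate (n + 1) i) < a i := by
  induction v using Fin.induction with
  | zero => exact absurd h (by simp [Fin.le_zero_iff.mp huv])
  | succ i ih =>
    have hu : u ≤ i.castSucc := by
      have hne : u ≠ i.succ := by
        rintro rfl
        exact lt_irrefl _ h
      exact Fin.le_castSucc_iff.mpr (lt_of_le_of_ne huv hne)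
    by_cases hi : a i.castSucc < a u
    · obtain ⟨j, huj, hji, hj⟩ := ih hu hi
      exact ⟨j, huj, hji.trans i.castSucc_lt_succ, hj⟩
    · refine ⟨i.castSucc, hu, i.castSucc_lt_succ, ?_⟩
      rw [finRotate_apply, Fin.coeSucc_eq_succ]
      exact h.trans_le (not_lt.mp hi)

/-- A descent of a subsequence at `j` comes from a descent of the sequence lying cyclically
between the selected position `p j` and the next selected position. -/
theorem exists_descent_of_descent_comp (a : Fin (n + 1) → α) (p : Fin (m + 1) → Fin (n + 1))
    (hp : StrictMono p) {j : Fin (m + 1)} (h : a (p (finRotate (m + 1) j)) < a (p j)) :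
    ∃ i, a (finRotate (n + 1) i) < a i ∧
      ((p j ≤ i ∧ ∀ l, j < l → i < p l) ∨ ((∀ l, l ≤ j) ∧ ∀ l, i < p l)) := by
  induction j using Fin.lastCases with
  | cast j =>
    rw [finRotate_apply, Fin.coeSucc_eq_succ] at h
    obtain ⟨i, hji, hij, hi⟩ :=
      exists_descent_of_lt_s16 a (hp.monotone j.castSucc_lt_succ.le) h
    exact ⟨i, hi, .inl ⟨hji, fun l hl =>
      hij.trans_le (hp.monotone (Fin.castSucc_lt_iff_succ_le.mp hl))⟩⟩
  | last =>
    rw [finRotate_last] at h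
    have hlast : ∀ i l, Fin.last m < l → i < p l := fun _ l hl =>
      absurd hl (Fin.le_last l).not_gt
    by_cases hend : a (Fin.last n) < a (p (Fin.last m))
    · obtain ⟨i, hji, -, hi⟩ := exists_descent_of_lt_s16 a (Fin.le_last _) hend
      exact ⟨i, hi, .inl ⟨hji, hlast i⟩⟩
    by_cases hstart : a (p 0) < a 0
    · obtain ⟨i, -, hij, hi⟩ := exists_descent_of_lt_s16 a (Fin.zero_le _) hstart
      exact ⟨i, hi, .inr ⟨Fin.le_last, fun l => hij.trans_le (hp.monotone (Fin.zero_le l))⟩⟩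
    · refine ⟨Fin.last n, ?_, .inl ⟨Fin.le_last _, hlast _⟩⟩
      rw [finRotate_last]
      exact ((not_lt.mp hstart).trans_lt h).trans_le (not_lt.mp hend)

end Descents

theorem IsCyclicSeq.comp_strictMono {α : Type*} [LinearOrder α] {t k : ℕ} {a : Fin t → α}
    (ha : IsCyclicSeq a) {p : Fin k → Fin t} (hp : StrictMono p) :
    IsCyclicSeq (fun j => a (p j)) := by
  obtain _ | m := k
  · simp [IsCyclicSeq]
  obtain _ | n := t
  · exact (p 0).elim0
  simp only [IsCyclicSeq, Finset.card_le_one, Finset.mem_filter_univ] at ha ⊢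
  have not_lt_of_descents : ∀ x, a (p (finRotate (m + 1) x)) < a (p x) →
      ∀ y, a (p (finRotate (m + 1) y)) < a (p y) → ¬ x < y := by
    intro x hx y hy hxy
    obtain ⟨i, hi, hxi⟩ := exists_descent_of_descent_comp a p hp hx
    obtain ⟨i', hi', hyi⟩ := exists_descent_of_descent_comp a p hp hy
    obtain rfl := ha i hi i' hi'
    obtain ⟨hxi, hix⟩ | ⟨hx_max, -⟩ := hxi
    · obtain ⟨hyi, -⟩ | ⟨-, hlt⟩ := hyi
      · exact (hix y hxy).not_ge hyi
      · exact (hlt x).not_ge hxi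
    · exact (hx_max y).not_gt hxy
  intro x hx y hy
  exact le_antisymm (not_lt.mp (not_lt_of_descents y hy x hx))
    (not_lt.mp (not_lt_of_descents x hx y hy))

theorem isCyclicSeq_toDual_iff {α : Type*} [LinearOrder α] {t : ℕ} {a : Fin t → α} :
    IsCyclicSeq (fun i => OrderDual.toDual (a i)) ↔ IsAntiCyclicSeq a := by
  simp only [IsCyclicSeq, IsAntiCyclicSeq, OrderDual.toDual_lt_toDual]

theorem IsAntiCyclicSeq.comp_strictMono {α : Type*} [LinearOrder α] {t k : ℕ} {a : Fin t → α}
    (ha : IsAntiCyclicSeq a) {p : Fin k → Fin t} (hp : StrictMono p) :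
    IsAntiCyclicSeq (fun j => a (p j)) :=
  isCyclicSeq_toDual_iff.mp ((isCyclicSeq_toDual_iff.mpr ha).comp_strictMono hp)

/-- Orientation is inherited by subsequences: for a strictly monotone
selection `p` of indices, a subsequence of a cyclic (anti-cyclic, oriented) sequence is
cyclic (anti-cyclic, oriented). -/
theorem orientation_inherited_by_subsequences (t k : ℕ) (ht : 1 ≤ t) (hk : 1 ≤ k)
    (a : Fin t → ℕ) (p : Fin k → Fin t) (hp : StrictMono p) :
    (IsCyclicSeq a → IsCyclicSeq (fun j => a (p j))) ∧
    (IsAntiCyclicSeq a → IsAntiCyclicSeq (fun j => a (p j))) ∧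
    (IsOrientedSeq a → IsOrientedSeq (fun j => a (p j))) := by
  exact ⟨fun h => h.comp_strictMono hp, fun h => h.comp_strictMono hp,
    Or.imp (fun h => h.comp_strictMono hp) (fun h => h.comp_strictMono hp)⟩
end

section
/- If a finite sequence S of natural numbers has at most 2 distinct entries (|S| ≤ 2), then S is cyclic if and only if S is anti-cyclic; that is, S is either both cyclic and anti-cyclic, or neither. -/
/-- A function with at most two values goes up along a permutation as often as it goes down. -/
theorem card_descents_eq_card_ascents {ι α : Type*} [Fintype ι] [LinearOrder α]
    (σ : Equiv.Perm ι) (a : ι → α) (h : (Finset.univ.image a).card ≤ 2) :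
    (Finset.univ.filter fun i => a (σ i) < a i).card =
      (Finset.univ.filter fun i => a i < a (σ i)).card := by
  classical
  cases isEmpty_or_nonempty ι
  · simp [Finset.univ_eq_empty]
  obtain ⟨k, -, hk⟩ := Finset.exists_max_image Finset.univ a Finset.univ_nonempty
  have key : ∀ i j, a i < a j ↔ a j = a k ∧ ¬ a i = a k := by
    intro i j
    refine ⟨fun hij => ?_, fun ⟨hj, hi⟩ => hj ▸ lt_of_le_of_ne (hk i (Finset.mem_univ i)) hi⟩
    refine ⟨?_, (hij.trans_le (hk j (Finset.mem_univ j))).ne⟩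
    by_contra hj
    have hjk : a j < a k := lt_of_le_of_ne (hk j (Finset.mem_univ j)) hj
    exact h.not_gt (Finset.two_lt_card.2 ⟨a i, by simp, a j, by simp, a k, by simp,
      hij.ne, (hij.trans hjk).ne, hjk.ne⟩)
  simp only [key, Finset.filter_and_not]
  refine Finset.card_sdiff_comm ?_
  exact (Finset.card_equiv σ fun i => by simp).symm

/-- If a sequence has at most 2 distinct entries, then it is cyclic iff it
is anti-cyclic. -/
theorem two_values_cyclic_iff_anticyclic (t : ℕ) (ht : 1 ≤ t) (a : Fin t → ℕ)
    (h : (Finset.univ.image a).card ≤ 2) :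
    IsCyclicSeq a ↔ IsAntiCyclicSeq a := by
  unfold IsCyclicSeq IsAntiCyclicSeq
  rw [card_descents_eq_card_ascents (finRotate t) a h]
end
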